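/- (Theorem C, (i)⇒(ii)) Assume R is not Gorenstein (equivalently, r ≥ 2), and let A be a non-zero minimal acyclic complex of finitely generated free R-modules. If the set {i ∈ ℤ : H_i(A*) = 0} contains infinitely many positive integers, then all the free modules A_i have the same rank. -/

import Mathlib

open IsLocalRing CategoryTheory

/-- The length of an `R`-module `M`: the supremum of the lengths of strictly increasing
chains of submodules of `M`.  For a module annihilated by the maximal ideal of a local
ring this coincides with the dimension over the residue field `k`. -/
noncomputable def moduleLength (R M : Type) [Ring R] [AddCommGroup M] [Module R M] : ℕ∞ :=
  ⨆ p : LTSeries (Submodule R M), (p.length : ℕ∞)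

/-- `Ext^n_R(M, N)`, as an object of `ModuleCat R`. -/
noncomputable def extModule (R : Type) [CommRing R] (M N : Type) [AddCommGroup M] [Module R M]
    [AddCommGroup N] [Module R N] (n : ℕ) : ModuleCat R :=
  ((Ext R (ModuleCat R) n).obj (Opposite.op (ModuleCat.of R M))).obj (ModuleCat.of R N)

/-- The `i`-th Betti number `β_i^R(M) = dim_k Ext^i_R(M, k)` of a module `M` over a local
ring `(R, m, k)`, computed as the length over `R` of `Ext^i_R(M, k)` (an `R`-module
annihilated by `m`, hence a `k`-vector space). -/
noncomputable def bettiNum (R : Type) [CommRing R] [IsLocalRing R] (M : Type) [AddCommGroup M]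
    [Module R M] (i : ℕ) : ℕ∞ :=
  moduleLength R (extModule R M (ResidueField R) i).carrier

/-- The `i`-th Bass number `μ^i_R = dim_k Ext^i_R(k, R)` of a local ring `(R, m, k)`. -/
noncomputable def bassNum (R : Type) [CommRing R] [IsLocalRing R] (i : ℕ) : ℕ∞ :=
  moduleLength R (extModule R (ResidueField R) R i).carrier

/-- The socle `Soc R = (0 :_R m)` of a local ring `(R, m)`. -/
noncomputable def socle (R : Type) [CommRing R] [IsLocalRing R] : Ideal R :=
  Submodule.colon (⊥ : Ideal R) (maximalIdeal R)

/-- The socle dimension `r = dim_k (0 :_R m)` of a local ring `(R, m, k)`. -/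
noncomputable def socdim (R : Type) [CommRing R] [IsLocalRing R] : ℕ∞ :=
  moduleLength R (socle R)

/-- The embedding dimension `e = dim_k (m/m²)` of a local ring `(R, m, k)`. -/
noncomputable def embdim (R : Type) [CommRing R] [IsLocalRing R] : ℕ∞ :=
  moduleLength R (CotangentSpace R)

/-- The residue field `k` is (isomorphic to) a direct summand of the `R`-module `M`,
expressed by a split injection `k → M`. -/
def kSummand (R : Type) [CommRing R] [IsLocalRing R] (M : Type) [AddCommGroup M]
    [Module R M] : Prop :=
  ∃ (f : M →ₗ[R] ResidueField R) (g : ResidueField R →ₗ[R] M), f ∘ₗ g = LinearMap.id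

/-- Vanishing of the `i`-th homology of the dual complex `A* = Hom_R(A, R)` of a chain
complex `A` with differentials `d i : A (i+1) → A i` (so that `∂_j = d (j-1)`):
every functional on `A_i` vanishing on the image of `∂_{i+1}` factors through `∂_i`.
(The index `i` is written as `i - 1 + 1` for type-checking reasons.)  Together with the
automatic inclusion `im ∂*_i ⊆ ker ∂*_{i+1}`, this says exactly `H_i(A*) = 0`. -/
def dualHomologyIsZero (R : Type) [CommRing R] (A : ℤ → Type) [∀ i, AddCommGroup (A i)]
    [∀ i, Module R (A i)] (d : ∀ i : ℤ, A (i + 1) →ₗ[R] A i) (i : ℤ) : Prop :=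
  ∀ f : A (i - 1 + 1) →ₗ[R] R, f ∘ₗ d (i - 1 + 1) = 0 →
    ∃ g : A (i - 1) →ₗ[R] R, f = g ∘ₗ d (i - 1)


/-- Vanishing of `Ext^n_R(N, R)`. -/
def EV (R : Type) [CommRing R] (N : Type) [AddCommGroup N] [Module R N] (n : ℕ) : Prop :=
  ∀ x : Abelian.Ext (ModuleCat.of R N) (ModuleCat.of R R) n, x = 0

section ExtPart

variable {R : Type} [CommRing R]
variable {N₁ N₂ N₃ : Type} [AddCommGroup N₁] [Module R N₁] [AddCommGroup N₂] [Module R N₂]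
  [AddCommGroup N₃] [Module R N₃]

lemma mkSES (f : N₁ →ₗ[R] N₂) (g : N₂ →ₗ[R] N₃) (hf : Function.Injective f)
    (hg : Function.Surjective g) (hfg : Function.Exact f g) :
    ∃ w : ModuleCat.ofHom f ≫ ModuleCat.ofHom g = 0,
      (ShortComplex.mk (ModuleCat.ofHom f) (ModuleCat.ofHom g) w).ShortExact := by
  refine ⟨?_, ?_⟩
  · ext x
    exact hfg.apply_apply_eq_zero x
  · refine ShortComplex.ShortExact.mk' ?_ ?_ ?_
    · rw [ShortComplex.moduleCat_exact_iff]
      intro x hx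
      exact (hfg x).1 hx
    · exact (ModuleCat.mono_iff_injective _).2 hf
    · exact (ModuleCat.epi_iff_surjective _).2 hg

lemma EV_retract (f : N₂ →ₗ[R] N₁) (g : N₁ →ₗ[R] N₂) (h : f ∘ₗ g = LinearMap.id) {n : ℕ}
    (hE : EV R N₂ n) : EV R N₁ n := by
  intro x
  have h1 := hE ((Abelian.Ext.mk₀ (ModuleCat.ofHom f)).comp x (zero_add n))
  have h2 := congrArg (fun y => (Abelian.Ext.mk₀ (ModuleCat.ofHom g)).comp y (zero_add n)) h1
  simp only [Abelian.Ext.mk₀_comp_mk₀_assoc, Abelian.Ext.comp_zero] at h2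
  rw [← ModuleCat.ofHom_comp, h, ModuleCat.ofHom_id, Abelian.Ext.mk₀_id_comp] at h2
  exact h2

lemma EV_subsingleton [Subsingleton N₁] (n : ℕ) : EV R N₁ n := by
  intro x
  have h0 : 𝟙 (ModuleCat.of R N₁) = 0 := by
    ext y
    exact Subsingleton.elim (α := N₁) _ _
  rw [← Abelian.Ext.mk₀_id_comp x, h0, Abelian.Ext.mk₀_zero, Abelian.Ext.zero_comp]

lemma EV_projective [Module.Projective R N₁] (n : ℕ) : EV R N₁ (n + 1) := by
  intro x
  exact Abelian.Ext.eq_zero_of_projective x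

lemma EV_middle (f : N₁ →ₗ[R] N₂) (g : N₂ →ₗ[R] N₃) (hf : Function.Injective f)
    (hg : Function.Surjective g) (hfg : Function.Exact f g) {n : ℕ}
    (h1 : EV R N₁ n) (h3 : EV R N₃ n) : EV R N₂ n := by
  obtain ⟨w, hS⟩ := mkSES f g hf hg hfg
  intro x
  obtain ⟨y, hy⟩ := Abelian.Ext.contravariant_sequence_exact₂ hS _ x (h1 _)
  rw [← hy, h3 y, Abelian.Ext.comp_zero]

lemma EV_shift (f : N₁ →ₗ[R] N₂) (g : N₂ →ₗ[R] N₃) (hf : Function.Injective f)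
    (hg : Function.Surjective g) (hfg : Function.Exact f g) [Module.Projective R N₂] {n : ℕ}
    (h1 : EV R N₁ n) : EV R N₃ (n + 1) := by
  obtain ⟨w, hS⟩ := mkSES f g hf hg hfg
  intro x
  obtain ⟨y, hy⟩ := Abelian.Ext.contravariant_sequence_exact₃ hS _ x
    (EV_projective (R := R) (N₁ := N₂) n _) (add_comm 1 n)
  rw [← hy, h1 y, Abelian.Ext.comp_zero]

lemma EV_unshift (f : N₁ →ₗ[R] N₂) (g : N₂ →ₗ[R] N₃) (hf : Function.Injective f)
    (hg : Function.Surjective g) (hfg : Function.Exact f g) [Module.Projective R N₂] {n : ℕ}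
    (h3 : EV R N₃ (n + 2)) : EV R N₁ (n + 1) := by
  obtain ⟨w, hS⟩ := mkSES f g hf hg hfg
  intro x
  obtain ⟨y, hy⟩ := Abelian.Ext.contravariant_sequence_exact₁ hS _ x (n₁ := n + 2) (by omega)
    (h3 _)
  rw [← hy, EV_projective (R := R) (N₁ := N₂) n y, Abelian.Ext.comp_zero]

lemma EV_one (f : N₁ →ₗ[R] N₂) (g : N₂ →ₗ[R] N₃) (hf : Function.Injective f)
    (hg : Function.Surjective g) (hfg : Function.Exact f g) [Module.Projective R N₂]
    (h : ∀ φ : N₁ →ₗ[R] R, ∃ ψ : N₂ →ₗ[R] R, ψ ∘ₗ f = φ) : EV R N₃ 1 := by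
  obtain ⟨w, hS⟩ := mkSES f g hf hg hfg
  intro x
  obtain ⟨y, hy⟩ := Abelian.Ext.contravariant_sequence_exact₃ hS _ x
    (EV_projective (R := R) (N₁ := N₂) 0 _) (add_zero 1)
  obtain ⟨φ, rfl⟩ := (Abelian.Ext.mk₀_bijective _ _).2 y
  obtain ⟨ψ, hψ⟩ := h φ.hom
  have : φ = ModuleCat.ofHom f ≫ ModuleCat.ofHom ψ := by
    ext z
    exact (LinearMap.congr_fun hψ z).symm
  rw [← hy, this, ← Abelian.Ext.mk₀_comp_mk₀]
  exact hS.extClass_comp_assoc _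

lemma EV_one_extend (f : N₁ →ₗ[R] N₂) (g : N₂ →ₗ[R] N₃) (hf : Function.Injective f)
    (hg : Function.Surjective g) (hfg : Function.Exact f g) (h3 : EV R N₃ 1)
    (φ : N₁ →ₗ[R] R) : ∃ ψ : N₂ →ₗ[R] R, ψ ∘ₗ f = φ := by
  obtain ⟨w, hS⟩ := mkSES f g hf hg hfg
  obtain ⟨y, hy⟩ := Abelian.Ext.contravariant_sequence_exact₁ hS _
    (Abelian.Ext.mk₀ (ModuleCat.ofHom φ)) (add_zero 1) (h3 _)
  obtain ⟨ψ, rfl⟩ := (Abelian.Ext.mk₀_bijective _ _).2 y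
  rw [Abelian.Ext.mk₀_comp_mk₀] at hy
  have := (Abelian.Ext.mk₀_bijective _ _).1 hy
  refine ⟨ψ.hom, ?_⟩
  ext z
  exact congrArg (fun q => q.hom z) this

end ExtPart

section LocalPart

variable {R : Type} [CommRing R] [IsLocalRing R]

/-- A functional to the residue field separating a point from a submodule containing `m M`. -/
lemma exists_functional {M : Type} [AddCommGroup M] [Module R M] (N : Submodule R M)
    (hN : maximalIdeal R • (⊤ : Submodule R M) ≤ N) {y : M} (hy : y ∉ N) :
    ∃ φ : M →ₗ[R] ResidueField R, N ≤ LinearMap.ker φ ∧ φ y = 1 := by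
  have ht : Module.IsTorsionBySet R (M ⧸ N) (maximalIdeal R : Set R) := by
    rintro x ⟨a, ha⟩
    obtain ⟨z, rfl⟩ := N.mkQ_surjective x
    change a • N.mkQ z = 0
    rw [← map_smul, Submodule.mkQ_apply, Submodule.Quotient.mk_eq_zero]
    exact hN (Submodule.smul_mem_smul ha trivial)
  let _ : Module (ResidueField R) (M ⧸ N) := ht.module
  have _ : IsScalarTower R (ResidueField R) (M ⧸ N) := ht.isScalarTower
  have hy' : N.mkQ y ≠ 0 := by
    rwa [Submodule.mkQ_apply, Ne, Submodule.Quotient.mk_eq_zero]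
  obtain ⟨f, hf⟩ := Module.Projective.exists_dual_eq_one (ResidueField R) hy'
  refine ⟨(f.restrictScalars R) ∘ₗ N.mkQ, ?_, hf⟩
  intro x hx
  have : N.mkQ x = 0 := by rwa [Submodule.mkQ_apply, Submodule.Quotient.mk_eq_zero]
  simp only [LinearMap.mem_ker, LinearMap.comp_apply, this, map_zero]

/-- The map `k → M` hitting an element killed by `m`. -/
lemma exists_from_k {M : Type} [AddCommGroup M] [Module R M] (x : M)
    (hx : ∀ a ∈ maximalIdeal R, a • x = 0) :
    ∃ g : ResidueField R →ₗ[R] M, g 1 = x := by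
  refine ⟨Submodule.liftQ (maximalIdeal R) (LinearMap.toSpanSingleton R M x) ?_, ?_⟩
  · intro a ha
    simpa using hx a ha
  · exact (Submodule.liftQ_apply (maximalIdeal R) (LinearMap.toSpanSingleton R M x) 1).trans
      (one_smul R x)

lemma k_ext {M : Type} [AddCommGroup M] [Module R M] {f g : ResidueField R →ₗ[R] M}
    (h : f 1 = g 1) : f = g := by
  ext x
  obtain ⟨a, rfl⟩ := IsLocalRing.residue_surjective x
  have : IsLocalRing.residue R a = a • (1 : ResidueField R) := by
    rw [Algebra.smul_def, mul_one]; rfl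
  rw [this, map_smul, map_smul, h]

lemma EV_all [IsNoetherianRing R] (h3 : maximalIdeal R ^ 3 = ⊥) {n : ℕ} (hk : EV R (ResidueField R) n)
    (N : Type) [AddCommGroup N] [Module R N] (hN : Module.Finite R N) : EV R N n := by
  induction hN using IsNoetherianRing.induction_on_isQuotientEquivQuotientPrime R with
  | subsingleton N => exact EV_subsingleton n
  | quotient N p f =>
    have hp : p.1 = maximalIdeal R := by
      refine le_antisymm (IsLocalRing.le_maximalIdeal p.2.ne_top) ?_
      refine p.2.le_of_pow_le (n := 3) ?_
      rw [h3]; exact bot_le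
    rw [hp] at f
    exact EV_retract (N₂ := ResidueField R) f.symm.toLinearMap f.toLinearMap (by ext y; exact f.symm_apply_apply y) hk
  | exact N₁ N₂ N₃ f g hf hg hfg h₁ h₃ => exact EV_middle f g hf hg hfg h₁ h₃

lemma mem_socle_iff (t : R) : t ∈ socle R ↔ ∀ a ∈ maximalIdeal R, a * t = 0 := by
  unfold socle
  rw [Submodule.mem_colon]
  constructor
  · intro h a ha
    have := h a ha
    rw [mul_comm]
    simpa using this
  · intro h a ha
    have := h a ha
    rw [mul_comm] at this
    simpa using this

lemma exists_socle_sub (hr : 2 ≤ socdim R) : ∃ N : Submodule R (socle R), N ≠ ⊥ ∧ N ≠ ⊤ := by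
  have h1 : (1 : ℕ∞) < socdim R := lt_of_lt_of_le (by norm_num) hr
  unfold socdim moduleLength at h1
  obtain ⟨p, hp⟩ := lt_iSup_iff.1 h1
  have hp' : 1 < p.length := by exact_mod_cast hp
  refine ⟨p ⟨1, by omega⟩, ?_, ?_⟩
  · have : p ⟨0, by omega⟩ < p ⟨1, by omega⟩ :=
      p.strictMono (Fin.mk_lt_mk.2 (by norm_num))
    exact (lt_of_le_of_lt bot_le this).ne'
  · have : p ⟨1, by omega⟩ < p ⟨2, by omega⟩ :=
      p.strictMono (Fin.mk_lt_mk.2 (by norm_num))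
    exact (lt_of_lt_of_le this le_top).ne

lemma not_EV_one [IsNoetherianRing R] (h3 : maximalIdeal R ^ 3 = ⊥) (hr : 2 ≤ socdim R) :
    ¬ EV R (ResidueField R) 1 := by
  intro hE
  obtain ⟨N, hN0, hN1⟩ := exists_socle_sub hr
  have hq := EV_all h3 hE (R ⧸ socle R) inferInstance
  obtain ⟨x, hxN, hx0⟩ := (Submodule.ne_bot_iff N).1 hN0
  obtain ⟨y, hy⟩ : ∃ y, y ∉ N := by
    by_contra! h
    exact hN1 (eq_top_iff.2 fun z _ => h z)
  obtain ⟨φ, hφN, hφy⟩ := exists_functional N (by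
    rw [Submodule.smul_le]
    intro a ha z _
    have : a • z = 0 := by
      ext
      exact (mem_socle_iff _).1 z.2 a ha
    rw [this]; exact N.zero_mem) hy
  obtain ⟨g, hg⟩ := exists_from_k (M := R) y.1 ((mem_socle_iff _).1 y.2)
  obtain ⟨ψ, hψ⟩ := EV_one_extend (R := R) (socle R).subtype (socle R).mkQ
    (Submodule.subtype_injective _) (Submodule.mkQ_surjective _)
    (LinearMap.exact_subtype_mkQ _) hq (g ∘ₗ φ)
  have e1 : ∀ z : socle R, z.1 * ψ 1 = g (φ z) := by
    intro z
    have := LinearMap.congr_fun hψ z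
    simp only [LinearMap.comp_apply, Submodule.subtype_apply] at this
    rw [← this, ← smul_eq_mul, ← map_smul, smul_eq_mul, mul_one]
  have ex := e1 x
  have ey := e1 y
  rw [hφy, hg] at ey
  rw [show φ x = 0 from hφN hxN, map_zero] at ex
  have hc : ψ 1 ∈ maximalIdeal R := by
    rw [IsLocalRing.mem_maximalIdeal, mem_nonunits_iff]
    intro hu
    exact hx0 (by ext; exact (hu.mul_left_eq_zero).1 ex)
  have hy0 : y.1 = 0 := by
    rw [← ey, mul_comm]
    exact (mem_socle_iff _).1 y.2 _ hc
  exact hy (by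
    have : y = 0 := by ext; exact hy0
    rw [this]; exact N.zero_mem)

lemma not_EV [IsNoetherianRing R] (h3 : maximalIdeal R ^ 3 = ⊥) (hr : 2 ≤ socdim R) (n : ℕ) :
    ¬ EV R (ResidueField R) (n + 1) := by
  induction n with
  | zero => exact not_EV_one h3 hr
  | succ n ih =>
    intro hE
    apply ih
    obtain ⟨N, hN0, -⟩ := exists_socle_sub hr
    obtain ⟨x, -, hx0⟩ := (Submodule.ne_bot_iff N).1 hN0
    obtain ⟨g, hg⟩ := exists_from_k (M := R) x.1 ((mem_socle_iff _).1 x.2)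
    have hx1 : x.1 ≠ 0 := fun h => hx0 (by ext; exact h)
    refine EV_unshift g (LinearMap.range g).mkQ ?_ (Submodule.mkQ_surjective _) ?_
      (EV_all h3 hE (R ⧸ LinearMap.range g) inferInstance)
    · rw [← LinearMap.ker_eq_bot, Submodule.eq_bot_iff]
      intro z hz
      by_contra hz0
      obtain ⟨a, rfl⟩ := IsLocalRing.residue_surjective z
      have e : IsLocalRing.residue R a = a • (1 : ResidueField R) := by
        rw [Algebra.smul_def, mul_one]; rfl
      rw [LinearMap.mem_ker, e, map_smul, hg, smul_eq_mul] at hz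
      replace hz0 := (IsLocalRing.residue_ne_zero_iff_isUnit a).1 hz0
      exact hx1 ((hz0.mul_right_eq_zero).1 hz)
    · rw [LinearMap.exact_iff, Submodule.ker_mkQ]

/-- No `k`-summands when some `Ext` into `R` vanishes. -/
lemma socle_le_of_EV [IsNoetherianRing R] (h3 : maximalIdeal R ^ 3 = ⊥) (hr : 2 ≤ socdim R)
    {M : Type} [AddCommGroup M] [Module R M] {n : ℕ} (hE : EV R M (n + 1)) (x : M)
    (hx : ∀ a ∈ maximalIdeal R, a • x = 0) : x ∈ maximalIdeal R • (⊤ : Submodule R M) := by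
  by_contra hxm
  obtain ⟨φ, -, hφ⟩ := exists_functional _ le_rfl hxm
  obtain ⟨g, hg⟩ := exists_from_k x hx
  refine not_EV h3 hr n (EV_retract φ g ?_ hE)
  apply k_ext
  rw [LinearMap.comp_apply, hg, hφ]; rfl

end LocalPart

section Count

/-- A bi-infinite sequence of naturals with `a_{i+2} = e a_{i+1} - s a_i`, `s ≥ 2`, is constant. -/
lemma const_of_rec (a : ℤ → ℕ) (e s : ℤ) (hs : 2 ≤ s)
    (h : ∀ i, (a (i + 2) : ℤ) = e * a (i + 1) - s * a i) : ∀ i j, a i = a j := by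
  let D : ℤ → ℤ := fun i => (a (i + 2) : ℤ) * a i - (a (i + 1) : ℤ) ^ 2
  have hD : ∀ i, D (i + 1) = s * D i := by
    intro i
    have h1 := h i
    have h2 := h (i + 1)
    have e1 : i + 1 + 1 = i + 2 := by ring
    simp only [D]
    rw [e1] at h2 ⊢
    rw [h2, h1]
    ring
  have hpow : ∀ n : ℕ, ∀ i, s ^ n ∣ D i := by
    intro n
    induction n with
    | zero => intro i; simp
    | succ n ih =>
      intro i
      have := hD (i - 1)
      rw [sub_add_cancel] at this
      rw [this, pow_succ']
      exact mul_dvd_mul_left s (ih _)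
  have hD0 : ∀ i, D i = 0 := by
    intro i
    by_contra hne
    have hlt : ((D i).natAbs : ℤ) < s ^ (D i).natAbs := by
      have h1 : (D i).natAbs < 2 ^ (D i).natAbs := Nat.lt_two_pow_self
      calc ((D i).natAbs : ℤ) < 2 ^ (D i).natAbs := by exact_mod_cast h1
        _ ≤ s ^ (D i).natAbs := pow_le_pow_left₀ (by norm_num) hs _
    have hdv := hpow (D i).natAbs i
    have := Int.le_of_dvd (by positivity) ((dvd_abs _ _).2 hdv)
    rw [Int.abs_eq_natAbs] at this
    omega
  have hsq : ∀ i, a (i + 2) * a i = a (i + 1) ^ 2 := by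
    intro i
    have := hD0 i
    simp only [D] at this
    have h2 : (a (i + 2) : ℤ) * a i = (a (i + 1) : ℤ) ^ 2 := by linarith
    exact_mod_cast h2
  obtain ⟨i0, hi0⟩ : ∃ i0, ∀ j, a i0 ≤ a j := by
    obtain ⟨i0, h0⟩ := exists_minimal_of_wellFoundedLT (fun n => n ∈ Set.range a) ⟨a 0, 0, rfl⟩
    obtain ⟨⟨j, rfl⟩, h0⟩ := h0
    exact ⟨j, fun l => by
      rcases le_total (a j) (a l) with h | h
      · exact h
      · exact h0 ⟨l, rfl⟩ h⟩
  have key : ∀ i, a i = a i0 → a (i + 1) = a i0 ∧ a (i - 1) = a i0 := by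
    intro i hi
    have h1 := hsq (i - 1)
    have e1 : i - 1 + 2 = i + 1 := by ring
    rw [e1, sub_add_cancel, hi] at h1
    have h2 := hi0 (i + 1)
    have h3 := hi0 (i - 1)
    rcases Nat.eq_zero_or_pos (a i0) with h0 | h0
    · have h4 := hsq i
      have h5 := hsq (i - 2)
      have e2 : i - 2 + 2 = i := by ring
      have e3 : i - 2 + 1 = i - 1 := by ring
      rw [hi, h0] at h4
      rw [e2, e3, hi, h0] at h5
      rw [h0]
      constructor
      · exact pow_eq_zero_iff (two_ne_zero) |>.1 (by simpa using h4.symm)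
      · exact pow_eq_zero_iff (two_ne_zero) |>.1 (by simpa using h5.symm)
    · constructor <;> nlinarith
  have all : ∀ i, a i = a i0 := by
    intro i
    have hp : ∀ n : ℕ, a (i0 + n) = a i0 ∧ a (i0 - n) = a i0 := by
      intro n
      induction n with
      | zero => simp
      | succ n ih =>
        have h1 := (key _ ih.1).1
        have h2 := (key _ ih.2).2
        push_cast
        rw [← add_assoc, ← sub_sub]
        exact ⟨h1, h2⟩
    rcases le_total i0 i with h | h
    · have := (hp (i - i0).toNat).1
      rwa [Int.toNat_of_nonneg (by omega), add_sub_cancel] at this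
    · have := (hp (i0 - i).toNat).2
      rwa [Int.toNat_of_nonneg (by omega), sub_sub_cancel] at this
  intro i j
  rw [all i, all j]

end Count

section LengthPart

variable {R : Type} [CommRing R]

lemma moduleLength_eq (M : Type) [AddCommGroup M] [Module R M] :
    moduleLength R M = Module.length R M := by
  apply WithBot.coe_injective
  rw [Module.coe_length, Order.krullDim_eq_iSup_length]
  rfl

lemma mem_smul_top_basis {A ι : Type} [AddCommGroup A] [Module R A] [Fintype ι]
    (b : Module.Basis ι R A) (I : Ideal R) (x : A) :
    x ∈ I • (⊤ : Submodule R A) ↔ ∀ i, b.repr x i ∈ I := by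
  constructor
  · intro hx i
    have : I • (⊤ : Submodule R A) ≤ Submodule.comap (b.coord i) I := by
      rw [Submodule.smul_le]
      intro a ha z _
      simp only [Submodule.mem_comap, map_smul, smul_eq_mul]
      exact I.mul_mem_right _ ha
    exact this hx
  · intro h
    rw [← b.sum_repr x]
    exact Submodule.sum_mem _ fun i _ => Submodule.smul_mem_smul (h i) trivial

/-- `I A ≃ I^n` for a free module. -/
noncomputable def smulTopEquiv {A ι : Type} [AddCommGroup A] [Module R A] [Fintype ι]
    (b : Module.Basis ι R A) (I : Ideal R) :
    (I • (⊤ : Submodule R A) : Submodule R A) ≃ₗ[R] (ι → I) where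
  toFun x i := ⟨b.repr x.1 i, (mem_smul_top_basis b I x.1).1 x.2 i⟩
  map_add' x y := by ext i; simp
  map_smul' c x := by ext i; simp
  invFun v := ⟨∑ i, (v i).1 • b i, Submodule.sum_mem _ fun i _ =>
    Submodule.smul_mem_smul (v i).2 trivial⟩
  left_inv x := by ext; simp [b.sum_repr]
  right_inv v := by
    ext i
    exact congrFun (b.repr_sum_self (fun i => (v i).1)) i

lemma length_smul_top [Nontrivial R] {A : Type} [AddCommGroup A] [Module R A] [Module.Free R A]
    [Module.Finite R A] (I : Ideal R) :
    Module.length R (I • (⊤ : Submodule R A) : Submodule R A) =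
      Module.finrank R A * Module.length R I := by
  rw [(smulTopEquiv (Module.finBasis R A) I).length_eq, Module.length_pi]
  simp

/-- Length is additive along a submodule: `N' ≤ N`. -/
lemma length_sub_quot {M : Type} [AddCommGroup M] [Module R M] (N : Submodule R M) :
    Module.length R M = Module.length R N + Module.length R (M ⧸ N) :=
  Module.length_eq_add_of_exact N.subtype N.mkQ N.subtype_injective N.mkQ_surjective
    (LinearMap.exact_subtype_mkQ N)

lemma length_comap_subtype {M : Type} [AddCommGroup M] [Module R M] {N P : Submodule R M}
    (h : N ≤ P) : Module.length R (N.comap P.subtype) = Module.length R N :=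
  (Submodule.comapSubtypeEquivOfLe h).length_eq

end LengthPart

section Local2
variable {R : Type} [CommRing R] [IsLocalRing R] [IsNoetherianRing R]

lemma length_quot_m {A : Type} [AddCommGroup A] [Module R A] [Module.Free R A]
    [Module.Finite R A] (hf : Module.length R R ≠ ⊤) :
    Module.length R (A ⧸ (maximalIdeal R • (⊤ : Submodule R A))) = Module.finrank R A := by
  have h1 := length_sub_quot (maximalIdeal R • (⊤ : Submodule R A))
  have h2 : Module.length R R = Module.length R (maximalIdeal R) + 1 := by
    rw [length_sub_quot (maximalIdeal R)]
    congr 1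
    rw [Module.length_eq_one_iff]
    exact (isSimpleModule_iff_isCoatom).2 (IsLocalRing.maximalIdeal.isMaximal R).out
  rw [length_smul_top, Module.length_of_free_of_finite, h2] at h1
  have hm : Module.length R (maximalIdeal R) ≠ ⊤ := by
    intro h; rw [h, top_add] at h2; exact hf h2
  obtain ⟨t, ht⟩ := ENat.ne_top_iff_exists.1 hm
  rw [← ht, mul_add, mul_one] at h1
  refine (WithTop.add_left_cancel ?_ h1).symm
  exact_mod_cast ENat.natCast_ne_top _

/-- The basic counting step. -/
lemma count_step {A₀ A₁ A₂ : Type} [AddCommGroup A₀] [Module R A₀] [Module.Free R A₀]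
    [Module.Finite R A₀] [AddCommGroup A₁] [Module R A₁] [Module.Free R A₁]
    [Module.Finite R A₁] [AddCommGroup A₂] [Module R A₂] [Module.Free R A₂]
    [Module.Finite R A₂] (hf : Module.length R R ≠ ⊤)
    (d₁ : A₁ →ₗ[R] A₀) (d₂ : A₂ →ₗ[R] A₁) (hex : LinearMap.range d₂ = LinearMap.ker d₁)
    (hmin : LinearMap.range d₂ ≤ maximalIdeal R • (⊤ : Submodule R A₁))
    (hker : LinearMap.ker d₂ ≤ maximalIdeal R • (⊤ : Submodule R A₂))
    (h₁ : maximalIdeal R • LinearMap.range d₁ = maximalIdeal R ^ 2 • (⊤ : Submodule R A₀))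
    (h₂ : maximalIdeal R • LinearMap.range d₂ = maximalIdeal R ^ 2 • (⊤ : Submodule R A₁)) :
    (Module.finrank R A₁ : ℕ∞) * Module.length R (maximalIdeal R) =
      Module.finrank R A₁ * Module.length R (maximalIdeal R ^ 2 : Ideal R) +
      Module.finrank R A₂ +
      Module.finrank R A₀ * Module.length R (maximalIdeal R ^ 2 : Ideal R) := by
  set m := maximalIdeal R with hm
  -- first exact sequence
  have s1 : Module.length R (m • (⊤ : Submodule R A₁) : Submodule R A₁) =
      Module.length R (LinearMap.range d₂) +
      Module.length R (m ^ 2 • (⊤ : Submodule R A₀) : Submodule R A₀) := by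
    have hmap : Submodule.map d₁ (m • ⊤) = m ^ 2 • (⊤ : Submodule R A₀) := by
      rw [Submodule.map_smul'', Submodule.map_top, h₁]
    rw [← hmap]
    refine Module.length_eq_add_of_exact (Submodule.inclusion hmin)
      (d₁.submoduleMap (m • ⊤)) (Submodule.inclusion_injective hmin)
      (LinearMap.submoduleMap_surjective d₁ _) ?_
    intro x
    constructor
    · intro hx
      have hx' : d₁ x.1 = 0 := congrArg Subtype.val hx
      have : x.1 ∈ LinearMap.range d₂ := by rw [hex]; exact hx'
      exact ⟨⟨x.1, this⟩, by ext; rfl⟩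
    · rintro ⟨y, rfl⟩
      ext
      have : y.1 ∈ LinearMap.ker d₁ := by rw [← hex]; exact y.2
      exact this
  have hle : m ^ 2 • (⊤ : Submodule R A₁) ≤ LinearMap.range d₂ := by
    rw [← h₂]; exact Submodule.smul_le_right
  have s2 : Module.length R (LinearMap.range d₂) =
      Module.length R (m ^ 2 • (⊤ : Submodule R A₁) : Submodule R A₁) +
      Module.length R (A₂ ⧸ (m • (⊤ : Submodule R A₂))) := by
    rw [length_sub_quot ((m ^ 2 • (⊤ : Submodule R A₁)).comap (LinearMap.range d₂).subtype),
      length_comap_subtype hle]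
    congr 1
    let q := ((m ^ 2 • (⊤ : Submodule R A₁)).comap (LinearMap.range d₂).subtype).mkQ ∘ₗ
      d₂.rangeRestrict
    have hq : Function.Surjective q :=
      (Submodule.mkQ_surjective _).comp d₂.surjective_rangeRestrict
    have hkq : LinearMap.ker q = m • (⊤ : Submodule R A₂) := by
      ext x
      have : x ∈ LinearMap.ker q ↔ d₂ x ∈ m ^ 2 • (⊤ : Submodule R A₁) := by
        simp only [q, LinearMap.mem_ker, LinearMap.comp_apply, Submodule.mkQ_apply,
          Submodule.Quotient.mk_eq_zero, Submodule.mem_comap]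
        rfl
      rw [this, ← h₂, ← Submodule.map_top, ← Submodule.map_smul'']
      constructor
      · rintro ⟨y, hy, hxy⟩
        have : x - y ∈ m • (⊤ : Submodule R A₂) := hker (by
          rw [LinearMap.mem_ker, map_sub, hxy, sub_self])
        have := Submodule.add_mem _ this hy
        rwa [sub_add_cancel] at this
      · intro hx
        exact ⟨x, hx, rfl⟩
    rw [← hkq]
    exact ((q.quotKerEquivOfSurjective hq).length_eq).symm
  rw [length_quot_m hf, length_smul_top] at s2
  rw [length_smul_top, length_smul_top, s2] at s1
  exact s1

end Local2

section Main

variable {R : Type} [CommRing R]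

/-- Every functional on `range (d l)` extends to `A l`. -/
def extendsAt (R : Type) [CommRing R] (A : ℤ → Type) [∀ i, AddCommGroup (A i)]
    [∀ i, Module R (A i)] (d : ∀ i : ℤ, A (i + 1) →ₗ[R] A i) (l : ℤ) : Prop :=
  ∀ φ : LinearMap.range (d l) →ₗ[R] R, ∃ ψ : A l →ₗ[R] R,
    ψ ∘ₗ (LinearMap.range (d l)).subtype = φ

lemma extendsAt_of_dual (A : ℤ → Type) [∀ i, AddCommGroup (A i)] [∀ i, Module R (A i)]
    (d : ∀ i : ℤ, A (i + 1) →ₗ[R] A i) (hcx : ∀ i, d i ∘ₗ d (i + 1) = 0) (i : ℤ)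
    (h : dualHomologyIsZero R A d i) : extendsAt R A d (i - 1) := by
  intro φ
  obtain ⟨g, hg⟩ := h (φ ∘ₗ (d (i - 1)).rangeRestrict) (by
    ext x
    have : (d (i - 1)).rangeRestrict (d (i - 1 + 1) x) = 0 := by
      ext
      exact LinearMap.congr_fun (hcx (i - 1)) x
    simp only [LinearMap.comp_apply, this, map_zero, LinearMap.zero_apply])
  refine ⟨g, ?_⟩
  ext ⟨y, x, rfl⟩
  exact (LinearMap.congr_fun hg x).symm

lemma EV_of_extendsAt (A : ℤ → Type) [∀ i, AddCommGroup (A i)] [∀ i, Module R (A i)]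
    (hfree : ∀ i, Module.Free R (A i))
    (d : ∀ i : ℤ, A (i + 1) →ₗ[R] A i)
    (hacyclic : ∀ i, LinearMap.range (d (i + 1)) = LinearMap.ker (d i)) (n : ℕ) :
    ∀ l : ℤ, extendsAt R A d (l + 1 + n) → EV R (LinearMap.range (d l)) (n + 1) := by
  have hex : ∀ l, Function.Exact (LinearMap.range (d (l + 1))).subtype (d l).rangeRestrict := by
    intro l
    rw [LinearMap.exact_iff, LinearMap.ker_rangeRestrict, Submodule.range_subtype, hacyclic]
  induction n with
  | zero =>
    intro l h
    rw [Nat.cast_zero, add_zero] at h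
    exact EV_one _ _ (Submodule.subtype_injective _) (d l).surjective_rangeRestrict (hex l) h
  | succ n ih =>
    intro l h
    have e : l + 1 + ((n + 1 : ℕ) : ℤ) = l + 1 + 1 + n := by push_cast; ring
    rw [e] at h
    exact EV_shift _ _ (Submodule.subtype_injective _) (d l).surjective_rangeRestrict (hex l)
      (ih (l + 1) h)

end Main

/-- Theorem C, (i) ⇒ (ii): let `(R, m, k)` be a local ring with `m³ = 0 ≠ m²` which is
not Gorenstein (equivalently, `r ≥ 2`), and let `A` be a non-zero minimal acyclic
complex of finitely generated free `R`-modules.  If `{i : H_i(A*) = 0}` contains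
infinitely many positive integers, then all the free modules `A i` have the same
rank. -/
theorem theorem_C_i_ii (R : Type) [CommRing R] [IsNoetherianRing R] [IsLocalRing R]
    (h3 : maximalIdeal R ^ 3 = ⊥) (h2 : maximalIdeal R ^ 2 ≠ ⊥)
    (hnotGor : 2 ≤ socdim R)
    (A : ℤ → Type) [∀ i, AddCommGroup (A i)] [∀ i, Module R (A i)]
    (hfree : ∀ i, Module.Free R (A i)) (hfin : ∀ i, Module.Finite R (A i))
    (d : ∀ i : ℤ, A (i + 1) →ₗ[R] A i)
    (hcx : ∀ i, d i ∘ₗ d (i + 1) = 0)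
    (hacyclic : ∀ i, LinearMap.range (d (i + 1)) = LinearMap.ker (d i))
    (hmin : ∀ i, LinearMap.range (d i) ≤ maximalIdeal R • (⊤ : Submodule R (A i)))
    (hnz : ∃ i, Nontrivial (A i))
    (hinf : {i : ℤ | 0 < i ∧ dualHomologyIsZero R A d i}.Infinite) :
    ∀ i j : ℤ, Module.finrank R (A i) = Module.finrank R (A j) := by
  classical
  have hart : IsArtinianRing R :=
    (isArtinianRing_iff_isNilpotent_maximalIdeal R).2 ⟨3, h3⟩
  have hlen : Module.length R R ≠ ⊤ := Module.length_ne_top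
  set m := maximalIdeal R with hm
  -- vanishing of Ext
  have hEV : ∀ l : ℤ, ∃ n : ℕ, EV R (LinearMap.range (d l)) (n + 1) := by
    intro l
    obtain ⟨i, hi, hil⟩ : ∃ i, i ∈ {i : ℤ | 0 < i ∧ dualHomologyIsZero R A d i} ∧ l + 2 ≤ i := by
      by_contra! hcon
      exact hinf ((Set.finite_Icc 0 (l + 2)).subset fun i hi => ⟨hi.1.le, (hcon i hi).le⟩)
    refine ⟨(i - 1 - (l + 1)).toNat, EV_of_extendsAt A hfree d hacyclic _ l ?_⟩
    rw [Int.toNat_of_nonneg (by omega), add_sub_cancel]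
    exact extendsAt_of_dual A d hcx i hi.2
  -- no residue field summands
  have hsoc : ∀ (l : ℤ) (x : A l), x ∈ LinearMap.range (d l) → (∀ a ∈ m, a • x = 0) →
      x ∈ m • LinearMap.range (d l) := by
    intro l x hx hxm
    obtain ⟨n, hn⟩ := hEV l
    have := socle_le_of_EV h3 hnotGor hn ⟨x, hx⟩ (fun a ha => by ext; exact hxm a ha)
    exact (Submodule.mem_smul_top_iff m _ ⟨x, hx⟩).1 this
  have hkill : ∀ (l : ℤ) (x : A l), x ∈ m ^ 2 • (⊤ : Submodule R (A l)) →
      ∀ a ∈ m, a • x = 0 := by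
    intro l x hx a ha
    have : a • x ∈ m • (m ^ 2 • (⊤ : Submodule R (A l))) := Submodule.smul_mem_smul ha hx
    rw [← Submodule.mul_smul, ← pow_succ', h3, Submodule.bot_smul] at this
    exact (Submodule.mem_bot R).1 this
  have hsq' : ∀ l : ℤ, m • LinearMap.range (d (l + 1)) =
      m ^ 2 • (⊤ : Submodule R (A (l + 1))) := by
    intro l
    apply le_antisymm
    · calc m • LinearMap.range (d (l + 1)) ≤ m • (m • ⊤) := Submodule.smul_mono le_rfl (hmin _)
        _ = m ^ 2 • ⊤ := by rw [← Submodule.mul_smul, pow_two]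
    · intro x hx
      refine hsoc (l + 1) x ?_ (hkill _ x hx)
      rw [hacyclic]
      have h1 : d l x ∈ m ^ 2 • (LinearMap.range (d l)) := by
        rw [← Submodule.map_top, ← Submodule.map_smul'']
        exact ⟨x, hx, rfl⟩
      have h2' : m ^ 2 • (LinearMap.range (d l)) ≤ m ^ 2 • (m • ⊤) :=
        Submodule.smul_mono le_rfl (hmin l)
      have h4 := h2' h1
      rw [← Submodule.mul_smul, ← pow_succ, h3, Submodule.bot_smul] at h4
      exact (Submodule.mem_bot R).1 h4
  have hsq : ∀ l : ℤ, m • LinearMap.range (d l) = m ^ 2 • (⊤ : Submodule R (A l)) := by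
    intro l
    have := hsq' (l - 1)
    rwa [sub_add_cancel] at this
  -- the socle is contained in `m ^ 2`
  have hsocle : socle R ≤ m ^ 2 := by
    intro t ht
    obtain ⟨i, hi⟩ := hnz
    obtain ⟨l, rfl⟩ : ∃ l, i = l + 1 := ⟨i - 1, by ring⟩
    let b := Module.finBasis R (A (l + 1))
    have hpos : 0 < Module.finrank R (A (l + 1)) := Module.finrank_pos_iff_of_free R _ |>.2 hi
    let z : Fin (Module.finrank R (A (l + 1))) := ⟨0, hpos⟩
    have htm : ∀ a ∈ m, a * t = 0 := (mem_socle_iff t).1 ht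
    have hkz : ∀ a ∈ m, a • (t • b z) = 0 := by
      intro a ha
      rw [smul_smul, htm a ha, zero_smul]
    have hmem : t • b z ∈ LinearMap.range (d (l + 1)) := by
      rw [hacyclic, LinearMap.mem_ker, map_smul]
      have h1 : d l (b z) ∈ m • (⊤ : Submodule R (A l)) := hmin l ⟨_, rfl⟩
      have h4 : m • (⊤ : Submodule R (A l)) ≤ LinearMap.ker (LinearMap.lsmul R (A l) t) := by
        rw [Submodule.smul_le]
        intro a ha y _
        rw [LinearMap.mem_ker, LinearMap.lsmul_apply, smul_smul, mul_comm, htm a ha, zero_smul]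
      exact h4 h1
    have h5 := hsoc (l + 1) _ hmem hkz
    rw [hsq, mem_smul_top_basis b] at h5
    have h6 := h5 z
    simpa using h6
  -- lengths
  have hfl : ∀ I : Ideal R, Module.length R I ≠ ⊤ := fun I => Module.length_ne_top
  obtain ⟨s, hs⟩ := ENat.ne_top_iff_exists.1 (hfl (m ^ 2))
  obtain ⟨t, ht⟩ := ENat.ne_top_iff_exists.1 (hfl m)
  have hs2 : 2 ≤ s := by
    have h1 : Module.length R (socle R) ≤ Module.length R (m ^ 2 : Ideal R) :=
      Module.length_le_of_injective (Submodule.inclusion hsocle)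
        (Submodule.inclusion_injective hsocle)
    unfold socdim at hnotGor
    rw [moduleLength_eq] at hnotGor
    have := hnotGor.trans h1
    rw [← hs] at this
    exact_mod_cast this
  have hrec : ∀ i : ℤ, Module.finrank R (A (i + 1)) * t = Module.finrank R (A (i + 1)) * s +
      Module.finrank R (A (i + 1 + 1)) + Module.finrank R (A i) * s := by
    intro i
    have := count_step hlen (d i) (d (i + 1)) (hacyclic i) (hmin (i + 1))
      (by rw [← hacyclic (i + 1)]; exact hmin (i + 1 + 1)) (hsq i) (hsq (i + 1))
    rw [← hm, ← hs, ← ht] at this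
    exact_mod_cast this
  refine const_of_rec (fun i => Module.finrank R (A i)) ((t : ℤ) - s) s (by exact_mod_cast hs2) ?_
  intro i
  have e : i + 2 = i + 1 + 1 := by ring
  rw [e]
  have h1 : (Module.finrank R (A (i + 1)) : ℤ) * t = Module.finrank R (A (i + 1)) * s +
      Module.finrank R (A (i + 1 + 1)) + Module.finrank R (A i) * s := by exact_mod_cast hrec i
  linarith
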